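/- Let p = 1.409, q = 1/p. There is no configuration of points Y₁, …, Y₁₁ (pairwise distances ≥ p) in the annulus p ≤ |Yⱼ| ≤ 1+p together with points X₁, …, X₈ (pairwise distances ≥ q, and distance ≥ p to every Yⱼ) in the annulus 1 ≤ |Xᵢ| ≤ 1+p, such that additionally for any two points among the Xᵢ, Yⱼ that both have norm larger than 1+q (resp. 1+p), their radial projections to the circle of radius 1+q (resp. 1+p) preserve the relevant distance lower bounds. In short, under the weighted-point hypotheses of the paper, one cannot have 11 points of weight 1 and 8 points of weight 1/2. -/

import Mathlib

open MeasureTheory in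
/-- Points on a circle of length `T` whose arcs of half-width `w i` are pairwise disjoint:
the total length of the arcs is at most `T`. -/
lemma AddCircle.sum_two_mul_le_of_lt_dist {ι : Type*} [Fintype ι] {T : ℝ} [Fact (0 < T)]
    (x : ι → AddCircle T) (w : ι → ℝ) (hw : ∀ i, 0 ≤ w i) (hwT : ∀ i, 2 * w i ≤ T)
    (h : ∀ i j, i ≠ j → w i + w j < dist (x i) (x j)) : ∑ i, 2 * w i ≤ T := by
  have hT : 0 < T := Fact.out
  have hdisj : Pairwise (Function.onFun Disjoint fun i => Metric.closedBall (x i) (w i)) :=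
    fun i j hij => Metric.closedBall_disjoint_closedBall (h i j hij)
  have hle := measure_mono (μ := (volume : Measure (AddCircle T)))
    (Set.subset_univ (⋃ i, Metric.closedBall (x i) (w i)))
  rw [measure_iUnion hdisj fun i => Metric.isClosed_closedBall.measurableSet,
    AddCircle.measure_univ, tsum_fintype] at hle
  simp only [AddCircle.volume_closedBall, min_eq_right (hwT _)] at hle
  rw [← ENNReal.ofReal_sum_of_nonneg fun i _ => by linarith [hw i]] at hle
  exact (ENNReal.ofReal_le_ofReal_iff hT.le).1 hle

lemma AddCircle.lt_norm_of_cos_lt {x δ : ℝ} (hδ : δ ≤ Real.pi)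
    (h : Real.cos x < Real.cos δ) : δ < ‖(x : AddCircle (2 * Real.pi))‖ := by
  by_contra! hle
  rw [AddCircle.norm_eq] at hle
  have hcos := Real.cos_le_cos_of_nonneg_of_le_pi (abs_nonneg _) hδ hle
  rw [Real.cos_abs, Real.cos_sub_int_mul_two_pi] at hcos
  linarith

/-- The Taylor lower bound `1 - x ^ 2 / 2 ≤ cos x`, sharpened by three angle doublings. -/
lemma Real.lt_cos_of_lt {x c : ℝ} (hx : |x| ≤ 2)
    (hc : c < 2 * (2 * (2 * (1 - (x / 8) ^ 2 / 2) ^ 2 - 1) ^ 2 - 1) ^ 2 - 1) :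
    c < Real.cos x := by
  have hx2 : x ^ 2 ≤ 4 := by nlinarith [sq_abs x, abs_nonneg x]
  have h8 := Real.one_sub_sq_div_two_le_cos (x := x / 8)
  have e4 : Real.cos (x / 4) = 2 * Real.cos (x / 8) ^ 2 - 1 := by
    rw [← Real.cos_two_mul]; ring_nf
  have e2 : Real.cos (x / 2) = 2 * Real.cos (x / 4) ^ 2 - 1 := by
    rw [← Real.cos_two_mul]; ring_nf
  have e1 : Real.cos x = 2 * Real.cos (x / 2) ^ 2 - 1 := by
    rw [← Real.cos_two_mul]; ring_nf
  have b8 : 31 / 32 ≤ 1 - (x / 8) ^ 2 / 2 := by nlinarith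
  have h4 : 2 * (1 - (x / 8) ^ 2 / 2) ^ 2 - 1 ≤ Real.cos (x / 4) := by
    rw [e4]; gcongr
  have b4 : 7 / 8 ≤ 2 * (1 - (x / 8) ^ 2 / 2) ^ 2 - 1 := by nlinarith
  have h2 : 2 * (2 * (1 - (x / 8) ^ 2 / 2) ^ 2 - 1) ^ 2 - 1 ≤ Real.cos (x / 2) := by
    rw [e2]; gcongr
  have b2 : 0 ≤ 2 * (2 * (1 - (x / 8) ^ 2 / 2) ^ 2 - 1) ^ 2 - 1 := by nlinarith
  refine hc.trans_le ?_
  rw [e1]; gcongr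

namespace EuclideanSpace

/-- The polar angle of a point of the plane. -/
noncomputable def polarAngle (P : EuclideanSpace ℝ (Fin 2)) : ℝ := Complex.arg ⟨P 0, P 1⟩

lemma norm_eq_norm_complex (P : EuclideanSpace ℝ (Fin 2)) : ‖P‖ = ‖(⟨P 0, P 1⟩ : ℂ)‖ := by
  rw [EuclideanSpace.norm_eq, Complex.norm_eq_sqrt_sq_add_sq, Fin.sum_univ_two]
  simp

lemma dist_sq_eq_polarAngle (P Q : EuclideanSpace ℝ (Fin 2)) :
    dist P Q ^ 2 = ‖P‖ ^ 2 + ‖Q‖ ^ 2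
      - 2 * ‖P‖ * ‖Q‖ * Real.cos (polarAngle P - polarAngle Q) := by
  have hx (R : EuclideanSpace ℝ (Fin 2)) : ‖R‖ * Real.cos (polarAngle R) = R 0 := by
    rw [norm_eq_norm_complex]; exact Complex.norm_mul_cos_arg _
  have hy (R : EuclideanSpace ℝ (Fin 2)) : ‖R‖ * Real.sin (polarAngle R) = R 1 := by
    rw [norm_eq_norm_complex]; exact Complex.norm_mul_sin_arg _
  have hd : dist P Q ^ 2 = (P 0 - Q 0) ^ 2 + (P 1 - Q 1) ^ 2 := by
    rw [EuclideanSpace.dist_eq, Real.sq_sqrt (by positivity), Fin.sum_univ_two]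
    simp [Real.dist_eq, sq_abs]
  rw [hd, ← hx P, ← hx Q, ← hy P, ← hy Q, Real.cos_sub]
  linear_combination ‖P‖ ^ 2 * Real.sin_sq_add_cos_sq (polarAngle P)
    + ‖Q‖ ^ 2 * Real.sin_sq_add_cos_sq (polarAngle Q)

/-- Two points at distance at least `D` in annuli `a ≤ r ≤ b` and `c ≤ r ≤ d` are seen from the
origin at an angle larger than `δ`, as soon as this holds for extremal radii. -/
lemma lt_dist_polarAngle {P Q : EuclideanSpace ℝ (Fin 2)} {a b c d C D δ : ℝ}
    (hD : 0 ≤ D) (hPQ : D ≤ dist P Q) (ha : 0 < a) (hc : 0 < c)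
    (hP : a ≤ ‖P‖ ∧ ‖P‖ ≤ b) (hQ : c ≤ ‖Q‖ ∧ ‖Q‖ ≤ d)
    (h₁ : a ^ 2 + c ^ 2 - D ^ 2 ≤ 2 * a * c * C) (h₂ : a ^ 2 + d ^ 2 - D ^ 2 ≤ 2 * a * d * C)
    (h₃ : b ^ 2 + c ^ 2 - D ^ 2 ≤ 2 * b * c * C) (h₄ : b ^ 2 + d ^ 2 - D ^ 2 ≤ 2 * b * d * C)
    (hδ : |δ| ≤ 2)
    (hC : C < 2 * (2 * (2 * (1 - (δ / 8) ^ 2 / 2) ^ 2 - 1) ^ 2 - 1) ^ 2 - 1) :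
    δ < dist (polarAngle P : AddCircle (2 * Real.pi)) (polarAngle Q) := by
  have hsq : D ^ 2 ≤ dist P Q ^ 2 := by gcongr
  rw [dist_sq_eq_polarAngle] at hsq
  rw [dist_eq_norm, ← AddCircle.coe_sub]
  refine AddCircle.lt_norm_of_cos_lt
    (by linarith [le_abs_self δ, Real.pi_gt_three]) ?_
  refine lt_of_le_of_lt ?_ (Real.lt_cos_of_lt hδ hC)
  generalize Real.cos (polarAngle P - polarAngle Q) = k at *
  obtain ⟨r, hr⟩ : ∃ r, r = ‖P‖ := ⟨_, rfl⟩
  obtain ⟨s, hs⟩ : ∃ s, s = ‖Q‖ := ⟨_, rfl⟩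
  rw [← hr, ← hs] at hsq
  rw [← hr] at hP
  rw [← hs] at hQ
  obtain ⟨har, hrb⟩ := hP
  obtain ⟨hcs, hsd⟩ := hQ
  have convex_r (t : ℝ) (hta : a ^ 2 + t ^ 2 - D ^ 2 ≤ 2 * a * t * C)
      (htb : b ^ 2 + t ^ 2 - D ^ 2 ≤ 2 * b * t * C) :
      r ^ 2 + t ^ 2 - D ^ 2 ≤ 2 * r * t * C := by
    rcases har.eq_or_lt with h | h
    · rw [← h]; exact hta
    have := mul_nonneg (sub_nonneg.2 hrb) (sub_nonneg.2 har)
    nlinarith [mul_le_mul_of_nonneg_left hta (sub_nonneg.2 hrb),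
      mul_le_mul_of_nonneg_left htb (sub_nonneg.2 har),
      mul_nonneg this (sub_pos.2 (h.trans_le hrb)).le]
  have hcor : r ^ 2 + s ^ 2 - D ^ 2 ≤ 2 * r * s * C := by
    have hc' := convex_r c h₁ h₃
    have hd' := convex_r d h₂ h₄
    rcases hcs.eq_or_lt with h | h
    · rw [← h]; exact hc'
    have := mul_nonneg (sub_nonneg.2 hsd) (sub_nonneg.2 hcs)
    nlinarith [mul_le_mul_of_nonneg_left hc' (sub_nonneg.2 hsd),
      mul_le_mul_of_nonneg_left hd' (sub_nonneg.2 hcs),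
      mul_nonneg this (sub_pos.2 (h.trans_le hsd)).le]
  have hrs : 0 < r * s := mul_pos (ha.trans_le har) (hc.trans_le hcs)
  nlinarith

end EuclideanSpace

local instance : Fact (0 < 2 * Real.pi) := ⟨Real.two_pi_pos⟩

/-- Adjoining a point at angle larger than `v + w` from points that are pairwise at angle larger
than `2 * w`. -/
lemma AddCircle.card_mul_add_le {n : ℕ} (z : AddCircle (2 * Real.pi))
    (x : Fin n → AddCircle (2 * Real.pi)) {v w : ℝ} (hv : 0 ≤ v) (hw : 0 ≤ w)
    (hv3 : v ≤ 3) (hw3 : w ≤ 3)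
    (hx : ∀ i j, i ≠ j → 2 * w < dist (x i) (x j)) (hz : ∀ i, v + w < dist z (x i)) :
    n * (2 * w) + 2 * v ≤ 2 * Real.pi := by
  have hpi := Real.pi_gt_three
  have key := AddCircle.sum_two_mul_le_of_lt_dist (T := 2 * Real.pi)
    (fun o : Option (Fin n) => o.elim z x) (fun o => o.elim v fun _ => w)
    (by rintro (_ | i) <;> simpa) (by rintro (_ | i) <;> simp <;> linarith) ?_
  · simp only [Fintype.sum_option, Option.elim, Finset.sum_const, Finset.card_univ,
      Fintype.card_fin, nsmul_eq_mul] at key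
    linarith
  · rintro (_ | i) (_ | j) hij
    · exact absurd rfl hij
    · exact hz j
    · simpa [dist_comm, add_comm] using hz i
    · have := hx i j (by simpa using hij)
      simpa [two_mul] using this


/-- Impossible: 11 points of weight 1 and 8 points of weight 1/2 under the
weighted-point hypotheses with p = 1.409, q = 1/p: weight-1 points lie in
p ≤ ρ ≤ 1+p with pairwise distances ≥ p, weight-1/2 points lie in 1 ≤ ρ ≤ 1+p
with pairwise distances ≥ q, cross distances ≥ p, and every pair of points of
the configuration is at distance at least max(|P|−1, |P'|−1). -/
theorem stmt_16 (Y : Fin 11 → EuclideanSpace ℝ (Fin 2))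
    (X : Fin 8 → EuclideanSpace ℝ (Fin 2))
    (hY : ∀ j, (1.409 : ℝ) ≤ ‖Y j‖ ∧ ‖Y j‖ ≤ 1 + 1.409)
    (hX : ∀ i, (1 : ℝ) ≤ ‖X i‖ ∧ ‖X i‖ ≤ 1 + 1.409)
    (hYY : ∀ j j', j ≠ j' → (1.409 : ℝ) ≤ dist (Y j) (Y j'))
    (hXX : ∀ i i', i ≠ i' → (1 / 1.409 : ℝ) ≤ dist (X i) (X i'))
    (hXY : ∀ i j, (1.409 : ℝ) ≤ dist (X i) (Y j))
    (hYY' : ∀ j j', j ≠ j' → max (‖Y j‖ - 1) (‖Y j'‖ - 1) ≤ dist (Y j) (Y j'))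
    (hXX' : ∀ i i', i ≠ i' → max (‖X i‖ - 1) (‖X i'‖ - 1) ≤ dist (X i) (X i'))
    (hXY' : ∀ i j, max (‖X i‖ - 1) (‖Y j‖ - 1) ≤ dist (X i) (Y j)) : False := by
  have hpi := Real.pi_lt_d4
  have hX_low : ∀ i, ‖X i‖ ≤ 1.2 := by
    intro i
    by_contra! hi
    have := AddCircle.card_mul_add_le (EuclideanSpace.polarAngle (X i))
      (fun j => (EuclideanSpace.polarAngle (Y j) : AddCircle (2 * Real.pi)))
      (v := 0.155) (w := 0.272) (by norm_num) (by norm_num) (by norm_num) (by norm_num)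
      (fun j j' hj => EuclideanSpace.lt_dist_polarAngle (C := 0.855) (by norm_num)
        (hYY j j' hj) (by norm_num) (by norm_num) (hY j) (hY j')
        (by norm_num) (by norm_num) (by norm_num) (by norm_num)
        (by norm_num [abs_of_pos]) (by norm_num))
      (fun j => EuclideanSpace.lt_dist_polarAngle (C := 0.9097) (by norm_num)
        (hXY i j) (by norm_num) (by norm_num) ⟨hi.le, (hX i).2⟩ (hY j)
        (by norm_num) (by norm_num) (by norm_num) (by norm_num)
        (by norm_num [abs_of_pos]) (by norm_num))
    norm_num at this
    linarith
  have hY_high : ∀ j, 1.5 ≤ ‖Y j‖ := by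
    intro j
    by_contra! hj
    have := AddCircle.card_mul_add_le (EuclideanSpace.polarAngle (Y j))
      (fun i => (EuclideanSpace.polarAngle (X i) : AddCircle (2 * Real.pi)))
      (v := 0.772) (w := 0.298) (by norm_num) (by norm_num) (by norm_num) (by norm_num)
      (fun i i' hi => EuclideanSpace.lt_dist_polarAngle (C := 0.8255) (by norm_num)
        (hXX i i' hi) (by norm_num) (by norm_num) ⟨(hX i).1, hX_low i⟩ ⟨(hX i').1, hX_low i'⟩
        (by norm_num) (by norm_num) (by norm_num) (by norm_num)
        (by norm_num [abs_of_pos]) (by norm_num))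
      (fun i => EuclideanSpace.lt_dist_polarAngle (C := 0.475) (by norm_num)
        ((hXY i j).trans_eq (dist_comm _ _)) (by norm_num) (by norm_num)
        ⟨(hY j).1, hj.le⟩ ⟨(hX i).1, hX_low i⟩
        (by norm_num) (by norm_num) (by norm_num) (by norm_num)
        (by norm_num [abs_of_pos]) (by norm_num))
    norm_num at this
    linarith
  have := AddCircle.sum_two_mul_le_of_lt_dist
    (fun j => (EuclideanSpace.polarAngle (Y j) : AddCircle (2 * Real.pi)))
    (fun _ => 0.286) (fun _ => by norm_num) (fun _ => by linarith [Real.pi_gt_three])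
    (fun j j' hj => EuclideanSpace.lt_dist_polarAngle (C := 0.84) (by norm_num)
      (hYY j j' hj) (by norm_num) (by norm_num)
      ⟨hY_high j, (hY j).2⟩ ⟨hY_high j', (hY j').2⟩
      (by norm_num) (by norm_num) (by norm_num) (by norm_num)
      (by norm_num [abs_of_pos]) (by norm_num))
  norm_num at this
  linarith
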